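/- Let Ω ⊆ ℂ be a domain, let k ∈ ℕ, let α₁, …, α_k ∈ ℂ, and let F₁, …, F_k : Ω → ℂ be quasiconformal maps, i.e., each F_j is a homeomorphism of Ω onto an open subset of ℂ with sup_{z∈Ω} H_{F_j}(z) < ∞. If E ⊆ Ω has 2-dimensional Lebesgue measure zero, then the image of E under the map z ↦ α₁F₁(z) + ⋯ + α_kF_k(z) has 2-dimensional Lebesgue measure zero. -/

import Mathlib

open Set Metric MeasureTheory Filter
open scoped NNReal ENNReal Topology

noncomputable section

/-- A (nonempty, open, connected) domain in the complex plane. -/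
def IsPlaneDomain (Ω : Set ℂ) : Prop := IsOpen Ω ∧ IsConnected Ω

/-- A family of open round discs (given by centers `c` and radii `r`) whose closures
are contained in `Ω` and are pairwise disjoint. -/
def IsSchottkyFamily {I : Type*} (Ω : Set ℂ) (c : I → ℂ) (r : I → ℝ) : Prop :=
  (∀ i, 0 < r i) ∧ (∀ i, closedBall (c i) (r i) ⊆ Ω) ∧
    Pairwise fun i j => Disjoint (closedBall (c i) (r i)) (closedBall (c j) (r j))

/-- `S` is a relative Schottky set in the domain `Ω`. -/
def IsRelativeSchottkySet (Ω S : Set ℂ) : Prop :=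
  IsPlaneDomain Ω ∧
    ∃ (I : Type) (c : I → ℂ) (r : I → ℝ),
      IsSchottkyFamily Ω c r ∧ S = Ω \ ⋃ i, ball (c i) (r i)

/-- A Jordan domain: a bounded domain whose boundary is an embedded circle, and which is
a connected component of the complement of its boundary. -/
def IsJordanDomain (Ω : Set ℂ) : Prop :=
  IsPlaneDomain Ω ∧ Bornology.IsBounded Ω ∧
    (∃ γ : ℂ → ℂ, ContinuousOn γ (sphere (0 : ℂ) 1) ∧ InjOn γ (sphere (0 : ℂ) 1) ∧
      γ '' sphere (0 : ℂ) 1 = frontier Ω) ∧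
    ∀ p ∈ Ω, connectedComponentIn (frontier Ω)ᶜ p = Ω

/-- `f : ℂ → ℂ` restricts to a homeomorphism from `S` onto `T`. -/
def IsHomeoOn (f : ℂ → ℂ) (S T : Set ℂ) : Prop :=
  ∃ e : S ≃ₜ T, ∀ z : S, (e z : ℂ) = f (z : ℂ)

/-- `f` is `η`-quasisymmetric on `X`. -/
def QuasisymmetricWith (η : ℝ≥0 ≃ₜ ℝ≥0) (f : ℂ → ℂ) (X : Set ℂ) : Prop :=
  ∀ p ∈ X, ∀ q ∈ X, ∀ s ∈ X, ∀ t : ℝ≥0,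
    dist p q ≤ (t : ℝ) * dist p s → dist (f p) (f q) ≤ (η t : ℝ) * dist (f p) (f s)

/-- `f` is locally quasisymmetric on `X`: its restriction to every compact subset of `X`
is quasisymmetric. -/
def LocallyQuasisymmetricOn (f : ℂ → ℂ) (X : Set ℂ) : Prop :=
  ∀ K ⊆ X, IsCompact K → ∃ η : ℝ≥0 ≃ₜ ℝ≥0, QuasisymmetricWith η f K

/-- `f` is locally bi-Lipschitz on `S`. -/
def LocallyBiLipschitzOn (f : ℂ → ℂ) (S : Set ℂ) : Prop :=
  ∀ p ∈ S, ∃ U ∈ 𝓝[S] p, ∃ L : ℝ, 1 ≤ L ∧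
    ∀ x ∈ U, ∀ y ∈ U,
      dist x y / L ≤ dist (f x) (f y) ∧ dist (f x) (f y) ≤ L * dist x y

/-- `L_F(p,r)`: sup of distances of images of points of `Ω` at distance `≤ r` from `p`. -/
noncomputable def supDistImage (F : ℂ → ℂ) (Ω : Set ℂ) (p : ℂ) (r : ℝ) : ℝ≥0∞ :=
  ⨆ q ∈ {q | q ∈ Ω ∧ dist p q ≤ r}, edist (F p) (F q)

/-- `l_F(p,r)`: inf of distances of images of points of `Ω` at distance `≥ r` from `p`. -/
noncomputable def infDistImage (F : ℂ → ℂ) (Ω : Set ℂ) (p : ℂ) (r : ℝ) : ℝ≥0∞ :=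
  ⨅ q ∈ {q | q ∈ Ω ∧ r ≤ dist p q}, edist (F p) (F q)

/-- The dilatation `H_F(p) = limsup_{r → 0+} L_F(p,r) / l_F(p,r)` of `F` (viewed as a map
of `Ω`) at the point `p`. -/
noncomputable def dilatationOn (F : ℂ → ℂ) (Ω : Set ℂ) (p : ℂ) : ℝ≥0∞ :=
  Filter.limsup (fun r : ℝ => supDistImage F Ω p r / infDistImage F Ω p r) (𝓝[>] (0 : ℝ))

/-- Cauchy–Schwarz for finite sums of extended nonnegative reals. -/
lemma ENNReal.sq_sum_le_sum_mul_sum {ι : Type*} (s : Finset ι) (e a b : ι → ℝ≥0∞)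
    (h : ∀ i ∈ s, e i ^ 2 ≤ a i * b i) :
    (∑ i ∈ s, e i) ^ 2 ≤ (∑ i ∈ s, a i) * ∑ i ∈ s, b i := by
  have hsq : ∀ x : ℝ≥0∞, (x ^ (1 / 2 : ℝ)) ^ (2 : ℝ) = x := fun x => by
    rw [← ENNReal.rpow_mul]; norm_num
  have h1 : ∀ i ∈ s, e i ≤ a i ^ (1 / 2 : ℝ) * b i ^ (1 / 2 : ℝ) := by
    intro i hi
    rw [← ENNReal.mul_rpow_of_nonneg _ _ (by norm_num)]
    calc e i = (e i ^ 2) ^ (1 / 2 : ℝ) := by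
          rw [← ENNReal.rpow_natCast, ← ENNReal.rpow_mul]; norm_num
      _ ≤ _ := ENNReal.rpow_le_rpow (h i hi) (by norm_num)
  have h2 := ENNReal.inner_le_Lp_mul_Lq s (fun i => a i ^ (1 / 2 : ℝ))
    (fun i => b i ^ (1 / 2 : ℝ)) Real.HolderConjugate.two_two
  simp only [hsq] at h2
  calc (∑ i ∈ s, e i) ^ 2
      ≤ ((∑ i ∈ s, a i) ^ (1 / 2 : ℝ) * (∑ i ∈ s, b i) ^ (1 / 2 : ℝ)) ^ 2 := by
        gcongr
        exact (Finset.sum_le_sum h1).trans h2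
    _ = _ := by
        rw [mul_pow, ← ENNReal.rpow_natCast, ← ENNReal.rpow_natCast]
        simp only [Nat.cast_ofNat, hsq]

/-- Cauchy–Schwarz for the Lebesgue integral of a single function. -/
lemma MeasureTheory.sq_lintegral_le {α : Type*} [MeasurableSpace α] (μ : Measure α)
    {g : α → ℝ≥0∞} (hg : AEMeasurable g μ) :
    (∫⁻ x, g x ∂μ) ^ 2 ≤ μ univ * ∫⁻ x, g x ^ 2 ∂μ := by
  have hsq : ∀ x : ℝ≥0∞, (x ^ (1 / 2 : ℝ)) ^ (2 : ℝ) = x := fun x => by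
    rw [← ENNReal.rpow_mul]; norm_num
  have h := ENNReal.lintegral_mul_le_Lp_mul_Lq μ Real.HolderConjugate.two_two
    (aemeasurable_const (b := (1 : ℝ≥0∞))) hg
  simp only [Pi.mul_apply, one_mul, ENNReal.one_rpow, lintegral_one] at h
  calc (∫⁻ x, g x ∂μ) ^ 2
      ≤ (μ univ ^ (1 / 2 : ℝ) * (∫⁻ x, g x ^ (2 : ℝ) ∂μ) ^ (1 / 2 : ℝ)) ^ 2 := by gcongr
    _ = _ := by
        rw [mul_pow, ← ENNReal.rpow_natCast, ← ENNReal.rpow_natCast]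
        simp only [Nat.cast_ofNat, hsq, ENNReal.rpow_ofNat]

/-- Single-scale length estimate: if the oscillation of `u` at scale `δ` around the points of `A`
is controlled by the mass of a measure `m`, so is the length of the image of `A`. -/
lemma sq_volume_image_le_of_sq_edist_le {u : ℝ → ℝ} {A : Set ℝ} {a b δ : ℝ} (hδ : 0 < δ)
    (hab : a ≤ b) (hA : A ⊆ Icc a b) (m : Measure ℝ) (C : ℝ≥0∞)
    (h : ∀ x ∈ A, ∀ t, dist x t ≤ δ → edist (u x) (u t) ^ 2 ≤ C * m (closedBall x (2 * δ))) :
    volume (u '' A) ^ 2 ≤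
      (⌊(b - a) / δ⌋₊ + 1 : ℕ) * (24 * C * m (Icc (a - 2 * δ) (b + 4 * δ))) := by
  set N := ⌊(b - a) / δ⌋₊ + 1 with hN
  have hNδ : (N : ℝ) * δ ≤ b - a + δ := by
    have := Nat.floor_le (div_nonneg (sub_nonneg.2 hab) hδ.le)
    rw [le_div_iff₀ hδ] at this
    rw [hN]; push_cast; linarith
  set T : ℤ → Set ℝ := fun j => Ico (a + j • δ) (a + (j + 1) • δ) with hT
  have hTd : Pairwise (Function.onFun Disjoint T) := pairwise_disjoint_Ico_add_zsmul a δ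
  set w : ℕ → ℝ≥0∞ := fun i => ∑ k ∈ Finset.range 6, m (T (i + k - 2)) with hw
  have hcover : u '' A ⊆ ⋃ i ∈ Finset.range N, u '' (A ∩ T i) := by
    rintro _ ⟨x, hx, rfl⟩
    have hxa : 0 ≤ (x - a) / δ := div_nonneg (sub_nonneg.2 (hA hx).1) hδ.le
    have h1 := Nat.floor_le hxa
    have h2 := Nat.lt_floor_add_one ((x - a) / δ)
    rw [le_div_iff₀ hδ] at h1
    rw [div_lt_iff₀ hδ] at h2
    refine mem_biUnion (x := ⌊(x - a) / δ⌋₊) ?_ ⟨x, ⟨hx, ?_⟩, rfl⟩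
    · simp only [Finset.coe_range, mem_Iio, hN]
      have : ⌊(x - a) / δ⌋₊ ≤ ⌊(b - a) / δ⌋₊ :=
        Nat.floor_le_floor (by gcongr; exact (hA hx).2)
      omega
    · simp only [hT, mem_Ico, zsmul_eq_mul]
      push_cast
      constructor <;> linarith
  have hpiece : ∀ i ∈ Finset.range N, volume (u '' (A ∩ T i)) ^ 2 ≤ 1 * (4 * C * w i) := by
    intro i _
    rcases (A ∩ T i).eq_empty_or_nonempty with he | ⟨x, hxA, hxT⟩
    · simp [he]
    simp only [hT, mem_Ico, zsmul_eq_mul] at hxT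
    push_cast at hxT
    have hball : m (closedBall x (2 * δ)) ≤ w i := by
      have : closedBall x (2 * δ) ⊆ ⋃ k ∈ Finset.range 6, T (i + (k : ℕ) - 2) := by
        intro t ht
        rw [Real.closedBall_eq_Icc, mem_Icc] at ht
        set j := ⌊(t - a) / δ⌋ with hj
        have h1 : (j : ℝ) ≤ (t - a) / δ := Int.floor_le _
        have h2 : (t - a) / δ < j + 1 := Int.lt_floor_add_one _
        rw [le_div_iff₀ hδ] at h1
        rw [div_lt_iff₀ hδ] at h2
        have h3 : (i : ℤ) - 2 < j + 1 := by
          have : ((i : ℝ) - 2) * δ < (j + 1) * δ := by linarith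
          have := lt_of_mul_lt_mul_right this hδ.le
          exact_mod_cast this
        have h4 : j < (i : ℤ) + 3 := by
          have : (j : ℝ) * δ < (i + 3) * δ := by linarith
          have := lt_of_mul_lt_mul_right this hδ.le
          exact_mod_cast this
        refine mem_biUnion (x := (j + 2 - i).toNat) ?_ ?_
        · simp only [Finset.coe_range, mem_Iio]; omega
        · have : (i : ℤ) + ((j + 2 - i).toNat : ℕ) - 2 = j := by omega
          rw [this]
          simp only [hT, mem_Ico, zsmul_eq_mul]
          push_cast
          constructor <;> linarith
      exact (measure_mono this).trans (measure_biUnion_finset_le _ _)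
    have hsub : u '' (A ∩ T i) ⊆ closedEBall (u x) ((C * w i) ^ (1 / 2 : ℝ)) := by
      rintro _ ⟨t, ⟨_, htT⟩, rfl⟩
      simp only [hT, mem_Ico, zsmul_eq_mul] at htT
      push_cast at htT
      have hd : dist x t ≤ δ := by rw [Real.dist_eq, abs_le]; constructor <;> linarith
      have h5 := (h x hxA t hd).trans (mul_le_mul_right hball C)
      rw [mem_closedEBall, edist_comm]
      calc edist (u x) (u t) = (edist (u x) (u t) ^ 2) ^ (1 / 2 : ℝ) := by
            rw [← ENNReal.rpow_natCast, ← ENNReal.rpow_mul]; norm_num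
        _ ≤ _ := ENNReal.rpow_le_rpow h5 (by norm_num)
    calc volume (u '' (A ∩ T i)) ^ 2 ≤ (2 * (C * w i) ^ (1 / 2 : ℝ)) ^ 2 := by
          gcongr
          exact (measure_mono hsub).trans_eq (Real.volume_closedEBall _ _)
      _ = 1 * (4 * C * w i) := by
          rw [mul_pow, ← ENNReal.rpow_natCast, ← ENNReal.rpow_natCast, ← ENNReal.rpow_mul]
          norm_num
          ring
  have hsum : ∑ i ∈ Finset.range N, w i ≤ 6 * m (Icc (a - 2 * δ) (b + 4 * δ)) := by
    rw [hw, Finset.sum_comm]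
    have : ∀ k ∈ Finset.range 6, ∑ i ∈ Finset.range N, m (T ((i : ℕ) + k - 2)) ≤
        m (Icc (a - 2 * δ) (b + 4 * δ)) := by
      intro k hk
      rw [← measure_biUnion_finset (f := fun i : ℕ => T ((i : ℕ) + k - 2))
        (fun i _ j _ hij => hTd (by simpa using hij)) (fun i _ => measurableSet_Ico)]
      refine measure_mono (iUnion₂_subset fun i hi => ?_)
      simp only [Finset.mem_range] at hi hk
      have hi' : (i : ℝ) + 1 ≤ N := by exact_mod_cast hi
      have hk' : (k : ℝ) ≤ 5 := by exact_mod_cast Nat.le_of_lt_succ hk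
      refine Ico_subset_Icc_self.trans (Icc_subset_Icc ?_ ?_) <;> rw [zsmul_eq_mul] <;> push_cast
      · nlinarith [mul_nonneg (add_nonneg (Nat.cast_nonneg (α := ℝ) i)
          (Nat.cast_nonneg (α := ℝ) k)) hδ.le]
      · nlinarith
    exact (Finset.sum_le_sum this).trans_eq (by simp)
  calc volume (u '' A) ^ 2 ≤ (∑ i ∈ Finset.range N, volume (u '' (A ∩ T i))) ^ 2 := by
        gcongr
        exact (measure_mono hcover).trans (measure_biUnion_finset_le _ _)
    _ ≤ (∑ i ∈ Finset.range N, 1) * ∑ i ∈ Finset.range N, 4 * C * w i :=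
        ENNReal.sq_sum_le_sum_mul_sum _ _ _ _ hpiece
    _ ≤ N * (24 * C * m (Icc (a - 2 * δ) (b + 4 * δ))) := by
        rw [← Finset.mul_sum]
        simp only [Finset.sum_const, Finset.card_range, nsmul_eq_mul, mul_one]
        have h6 : 4 * C * ∑ i ∈ Finset.range N, w i
            ≤ 24 * C * m (Icc (a - 2 * δ) (b + 4 * δ)) :=
          (mul_le_mul_right hsum (4 * C)).trans_eq (by ring)
        exact mul_le_mul_right h6 _

/-- Multi-scale length estimate along an interval. -/
lemma sq_edist_le_liminf_of_lt {g : ℝ → ℝ} {a b : ℝ} (hab : a < b)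
    (hg : ContinuousOn g (Icc a b)) (m : ℕ → Measure ℝ) {C : ℝ≥0∞} (hC : C ≠ ⊤)
    (h : ∀ x ∈ Icc a b, ∀ᶠ n : ℕ in atTop, ∀ t, dist x t ≤ 1 / ((n : ℝ) + 1) →
      edist (g x) (g t) ^ 2 ≤ C * m n (closedBall x (2 * (1 / ((n : ℝ) + 1)))))
    {α β : ℝ} (hα : α < a) (hβ : b < β) :
    edist (g a) (g b) ^ 2 ≤ 48 * C * ENNReal.ofReal (b - a) *
      liminf (fun n : ℕ => ((n : ℝ≥0∞) + 1) * m n (Ioo α β)) atTop := by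
  set u : ℝ → ℝ := fun x => dist (g a) (g x) with hu
  set A : ℕ → Set ℝ := fun M => {x ∈ Icc a b | ∀ n ≥ M, ∀ t, dist x t ≤ 1 / ((n : ℝ) + 1) →
      edist (g x) (g t) ^ 2 ≤ C * m n (closedBall x (2 * (1 / ((n : ℝ) + 1))))} with hA
  have hAmono : Monotone A := fun M M' hM x hx => ⟨hx.1, fun n hn => hx.2 n (hM.trans hn)⟩
  have hAU : ⋃ M, u '' A M = u '' Icc a b := by
    rw [← image_iUnion]
    congr 1
    refine Subset.antisymm (iUnion_subset fun M x hx => hx.1) fun x hx => ?_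
    obtain ⟨M, hM⟩ := eventually_atTop.1 (h x hx)
    exact mem_iUnion.2 ⟨M, hx, hM⟩
  have hlen : edist (g a) (g b) ≤ volume (u '' Icc a b) := by
    have hcont : ContinuousOn u (Icc a b) := (continuous_const.dist continuous_id).comp_continuousOn hg
    have := measure_mono (μ := volume) (intermediate_value_Icc hab.le hcont)
    simpa [Real.volume_Icc, hu, edist_dist] using this
  have hlim : Tendsto (fun M => volume (u '' A M) ^ 2) atTop (𝓝 (volume (u '' Icc a b) ^ 2)) := by
    rw [← hAU]
    exact ((ENNReal.continuous_pow 2).tendsto _).comp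
      (tendsto_measure_iUnion_atTop fun M M' hM => image_mono (hAmono hM))
  refine (pow_le_pow_left' hlen 2).trans (le_of_tendsto' hlim fun M => ?_)
  have hconst : 48 * C * ENNReal.ofReal (b - a) ≠ ⊤ := by finiteness
  rw [← ENNReal.liminf_const_mul_of_ne_top hconst]
  have hδ : Tendsto (fun n : ℕ => 1 / ((n : ℝ) + 1)) atTop (𝓝 0) :=
    tendsto_one_div_add_atTop_nhds_zero_nat
  refine le_liminf_of_le (by isBoundedDefault) ?_
  filter_upwards [eventually_ge_atTop M, hδ.eventually_lt_const (sub_pos.2 hab),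
    hδ.eventually_lt_const (div_pos (sub_pos.2 hα) two_pos),
    hδ.eventually_lt_const (div_pos (sub_pos.2 hβ) four_pos)] with n hn h1 h2 h3
  have hpos : (0 : ℝ) < n + 1 := by positivity
  have hkey := sq_volume_image_le_of_sq_edist_le (u := u) (A := A M) (one_div_pos.2 hpos) hab.le
    (fun x hx => hx.1) (m n) C (fun x hx t ht => le_trans (pow_le_pow_left' ?_ 2)
      (hx.2 n hn t ht))
  · have hN : ((⌊(b - a) / (1 / ((n : ℝ) + 1))⌋₊ + 1 : ℕ) : ℝ≥0∞) ≤
        2 * ENNReal.ofReal (b - a) * (n + 1) := by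
      have h4 : (0 : ℝ) ≤ (b - a) * (n + 1) := mul_nonneg (sub_pos.2 hab).le hpos.le
      have h5 : ((⌊(b - a) / (1 / ((n : ℝ) + 1))⌋₊ + 1 : ℕ) : ℝ) ≤ 2 * (b - a) * (n + 1) := by
        push_cast
        rw [div_div_eq_mul_div, div_one]
        have := Nat.floor_le h4
        rw [div_lt_iff₀ hpos] at h1
        linarith
      calc ((⌊(b - a) / (1 / ((n : ℝ) + 1))⌋₊ + 1 : ℕ) : ℝ≥0∞)
          = ENNReal.ofReal ((⌊(b - a) / (1 / ((n : ℝ) + 1))⌋₊ + 1 : ℕ) : ℝ) := by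
            rw [ENNReal.ofReal_natCast]
        _ ≤ ENNReal.ofReal (2 * (b - a) * (n + 1)) := ENNReal.ofReal_le_ofReal h5
        _ = _ := by
            rw [ENNReal.ofReal_mul (by linarith), ENNReal.ofReal_mul zero_le_two,
              ENNReal.ofReal_add (by positivity) zero_le_one]
            simp
    have hm : m n (Icc (a - 2 * (1 / ((n : ℝ) + 1))) (b + 4 * (1 / ((n : ℝ) + 1)))) ≤
        m n (Ioo α β) :=
      measure_mono fun x hx => ⟨by linarith [hx.1], by linarith [hx.2]⟩
    calc volume (u '' A M) ^ 2 ≤ _ := hkey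
      _ ≤ (2 * ENNReal.ofReal (b - a) * (n + 1)) * (24 * C * m n (Ioo α β)) := by gcongr
      _ = _ := by ring
  · rw [edist_dist, edist_dist]
    exact ENNReal.ofReal_le_ofReal (by
      simp only [hu, dist_comm (g a)]; exact abs_dist_sub_le ..)

lemma sq_edist_le_liminf {g : ℝ → ℝ} {a b : ℝ} (hab : a ≤ b)
    (hg : ContinuousOn g (Icc a b)) (m : ℕ → Measure ℝ) {C : ℝ≥0∞} (hC : C ≠ ⊤)
    (h : ∀ x ∈ Icc a b, ∀ᶠ n : ℕ in atTop, ∀ t, dist x t ≤ 1 / ((n : ℝ) + 1) →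
      edist (g x) (g t) ^ 2 ≤ C * m n (closedBall x (2 * (1 / ((n : ℝ) + 1))))) :
    edist (g a) (g b) ^ 2 ≤ 48 * C * ENNReal.ofReal (b - a) *
      liminf (fun n : ℕ => ((n : ℝ≥0∞) + 1) * m n (Ioo a b)) atTop := by
  rcases hab.eq_or_lt with rfl | hab
  · simp
  have hga : ContinuousWithinAt g (Ioo a b) a :=
    (hg a (left_mem_Icc.2 hab.le)).mono Ioo_subset_Icc_self
  have hgb : ContinuousWithinAt g (Ioo a b) b :=
    (hg b (right_mem_Icc.2 hab.le)).mono Ioo_subset_Icc_self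
  have hε : Tendsto (fun ε : ℝ => ε) (𝓝[>] 0) (𝓝 0) := nhdsWithin_le_nhds
  have hsmall : ∀ᶠ ε : ℝ in 𝓝[>] 0, ε < (b - a) / 2 :=
    hε.eventually_lt_const (by linarith)
  have hl : Tendsto (fun ε : ℝ => a + ε) (𝓝[>] 0) (𝓝[Ioo a b] a) := by
    refine tendsto_nhdsWithin_iff.2 ⟨by simpa using hε.const_add a, ?_⟩
    filter_upwards [hsmall, self_mem_nhdsWithin] with ε h1 (h2 : 0 < ε)
    exact ⟨by linarith, by linarith⟩
  have hr : Tendsto (fun ε : ℝ => b - ε) (𝓝[>] 0) (𝓝[Ioo a b] b) := by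
    refine tendsto_nhdsWithin_iff.2 ⟨by simpa using hε.const_sub b, ?_⟩
    filter_upwards [hsmall, self_mem_nhdsWithin] with ε h1 (h2 : 0 < ε)
    exact ⟨by linarith, by linarith⟩
  have hlim : Tendsto (fun ε : ℝ => edist (g (a + ε)) (g (b - ε)) ^ 2) (𝓝[>] 0)
      (𝓝 (edist (g a) (g b) ^ 2)) :=
    ((ENNReal.continuous_pow 2).tendsto _).comp ((hga.tendsto.comp hl).edist (hgb.tendsto.comp hr))
  refine le_of_tendsto hlim ?_
  filter_upwards [hsmall, self_mem_nhdsWithin] with ε h1 (h2 : 0 < ε)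
  have hsub : Icc (a + ε) (b - ε) ⊆ Icc a b := Icc_subset_Icc (by linarith) (by linarith)
  refine (sq_edist_le_liminf_of_lt (a := a + ε) (b := b - ε) (by linarith) (hg.mono hsub) m hC
    (fun x hx => h x (hsub hx)) (α := a) (β := b) (by linarith) (by linarith)).trans ?_
  gcongr
  · linarith
  · linarith

lemma ENNReal.sum_liminf_le_liminf_sum {ι : Type*} (s : Finset ι) (F : ι → ℕ → ℝ≥0∞) :
    ∑ i ∈ s, liminf (F i) atTop ≤ liminf (fun n => ∑ i ∈ s, F i n) atTop := by
  simp only [liminf_eq_iSup_iInf_of_nat]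
  rw [ENNReal.finsetSum_iSup_of_monotone]
  · refine iSup_mono fun n => le_iInf₂ fun k hk => Finset.sum_le_sum fun i _ => ?_
    exact iInf₂_le k hk
  · exact fun i n n' hn => le_iInf₂ fun k hk => iInf₂_le k (hn.trans hk)

/-- Absolute continuity from the multi-scale length estimate. -/
lemma absolutelyContinuousOnInterval_of_sq_edist_le {g : ℝ → ℝ} {a b : ℝ} (hab : a ≤ b)
    (hg : ContinuousOn g (Icc a b)) (m : ℕ → Measure ℝ) {C : ℝ≥0∞} (hC : C ≠ ⊤)
    (h : ∀ x ∈ Icc a b, ∀ᶠ n : ℕ in atTop, ∀ t, dist x t ≤ 1 / ((n : ℝ) + 1) →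
      edist (g x) (g t) ^ 2 ≤ C * m n (closedBall x (2 * (1 / ((n : ℝ) + 1)))))
    (hm : liminf (fun n : ℕ => ((n : ℝ≥0∞) + 1) * m n univ) atTop ≠ ⊤) :
    AbsolutelyContinuousOnInterval g a b := by
  set S := liminf (fun n : ℕ => ((n : ℝ≥0∞) + 1) * m n univ) atTop with hS
  have hK : 48 * C * S ≠ ⊤ := by finiteness
  set K : ℝ := (48 * C * S).toReal with hKdef
  have hKpos : 0 ≤ K := ENNReal.toReal_nonneg
  rw [absolutelyContinuousOnInterval_iff]
  intro ε hε
  refine ⟨ε ^ 2 / (K + 1), by positivity, fun E hE hlen => ?_⟩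
  obtain ⟨hE1, hE2⟩ := hE
  rw [uIcc_of_le hab] at hE1
  have hle : ∀ c ∈ Icc a b, ∀ d ∈ Icc a b, c ≤ d → edist (g c) (g d) ^ 2 ≤
      (48 * C * edist c d) * liminf (fun n : ℕ => ((n : ℝ≥0∞) + 1) * m n (uIoc c d)) atTop := by
    intro c hc d hd hcd
    rw [uIoc_of_le hcd]
    have hsub : Icc c d ⊆ Icc a b := Icc_subset_Icc hc.1 hd.2
    refine (sq_edist_le_liminf hcd (hg.mono hsub) m hC fun x hx => h x (hsub hx)).trans ?_
    rw [edist_comm c, edist_dist, Real.dist_eq, abs_of_nonneg (sub_nonneg.2 hcd)]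
    refine mul_le_mul_right (liminf_le_liminf (Eventually.of_forall fun n => ?_)) _
    exact mul_le_mul_right (measure_mono Ioo_subset_Ioc_self) _
  have hpair : ∀ i ∈ Finset.range E.1, edist (g (E.2 i).1) (g (E.2 i).2) ^ 2 ≤
      (48 * C * edist (E.2 i).1 (E.2 i).2) *
      liminf (fun n : ℕ => ((n : ℝ≥0∞) + 1) * m n (uIoc (E.2 i).1 (E.2 i).2)) atTop := by
    intro i hi
    obtain ⟨h1, h2⟩ := hE1 i hi
    rcases le_total (E.2 i).1 (E.2 i).2 with hcd | hcd
    · exact hle _ h1 _ h2 hcd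
    · rw [edist_comm, edist_comm (E.2 i).1, uIoc_comm]
      exact hle _ h2 _ h1 hcd
  have hsumD : ∑ i ∈ Finset.range E.1,
      liminf (fun n : ℕ => ((n : ℝ≥0∞) + 1) * m n (uIoc (E.2 i).1 (E.2 i).2)) atTop ≤ S := by
    refine (ENNReal.sum_liminf_le_liminf_sum _ _).trans
      (liminf_le_liminf (Eventually.of_forall fun n => ?_))
    rw [← Finset.mul_sum, ← measure_biUnion_finset hE2 (fun i _ => measurableSet_uIoc)]
    exact mul_le_mul_right (measure_mono (subset_univ _)) _
  have htot := (ENNReal.sq_sum_le_sum_mul_sum _ _ _ _ hpair).trans (mul_le_mul_right hsumD _)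
  simp only [edist_dist] at htot
  rw [← Finset.mul_sum, ← ENNReal.ofReal_sum_of_nonneg (fun _ _ => dist_nonneg),
    ← ENNReal.ofReal_sum_of_nonneg (fun _ _ => dist_nonneg), mul_right_comm,
    ← ENNReal.ofReal_toReal hK, ← hKdef, ← ENNReal.ofReal_mul hKpos,
    ← ENNReal.ofReal_pow (Finset.sum_nonneg fun _ _ => dist_nonneg),
    ENNReal.ofReal_le_ofReal_iff
      (mul_nonneg hKpos (Finset.sum_nonneg fun _ _ => dist_nonneg))] at htot
  refine lt_of_pow_lt_pow_left₀ 2 hε.le (htot.trans_lt ?_)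
  rw [lt_div_iff₀ (by positivity)] at hlen
  have : 0 ≤ ∑ i ∈ Finset.range E.1, dist (E.2 i).1 (E.2 i).2 :=
    Finset.sum_nonneg fun _ _ => dist_nonneg
  by_cases hz : ∑ i ∈ Finset.range E.1, dist (E.2 i).1 (E.2 i).2 = 0
  · rw [hz]; simpa using pow_pos hε 2
  · nlinarith

lemma tendsto_const_mul_nhdsGT_zero {c : ℝ} (hc : 0 < c) :
    Tendsto (fun r : ℝ => c * r) (𝓝[>] 0) (𝓝[>] 0) := by
  refine tendsto_nhdsWithin_iff.2 ⟨?_, ?_⟩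
  · have : Tendsto (fun r : ℝ => c * r) (𝓝 0) (𝓝 (c * 0)) := tendsto_id.const_mul c
    rw [mul_zero] at this
    exact this.mono_left nhdsWithin_le_nhds
  · filter_upwards [self_mem_nhdsWithin] with r (hr : 0 < r)
    exact mul_pos hc hr

lemma volume_closedBall_real_prod (p : ℝ × ℝ) (r : ℝ) :
    volume (closedBall p r) = ENNReal.ofReal (2 * r) ^ 2 := by
  rw [← closedBall_prod_same p.1 p.2 r, Measure.volume_eq_prod, Measure.prod_prod,
    Real.volume_closedBall, Real.volume_closedBall, sq]

lemma enorm_deriv_le_of_sq_edist_le {g : ℝ → ℝ} {x : ℝ} {p : ℝ × ℝ} {μ : Measure (ℝ × ℝ)}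
    {C J : ℝ≥0∞} (hC : C ≠ ⊤)
    (h : ∀ᶠ r in 𝓝[>] (0 : ℝ), ∀ t, dist x t ≤ r →
      edist (g x) (g t) ^ 2 ≤ C * μ (closedBall p (2 * r)))
    (hJ : Tendsto (fun r => μ (closedBall p r) / volume (closedBall p r)) (𝓝[>] 0) (𝓝 J)) :
    ‖deriv g x‖ₑ ≤ (16 * C * J) ^ (1 / 2 : ℝ) := by
  by_cases hd : DifferentiableAt ℝ g x
  swap
  · simp [deriv_zero_of_not_differentiableAt hd]
  have h1 := ((ENNReal.continuous_pow 2).tendsto _).comp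
    ((continuous_enorm.tendsto _).comp hd.hasDerivAt.tendsto_slope_zero_right)
  have h2 : Tendsto (fun r => 16 * C * (μ (closedBall p (2 * r)) / volume (closedBall p (2 * r))))
      (𝓝[>] 0) (𝓝 (16 * C * J)) :=
    ENNReal.Tendsto.const_mul (hJ.comp (tendsto_const_mul_nhdsGT_zero two_pos)) (Or.inr (by finiteness))
  have h3 : ‖deriv g x‖ₑ ^ 2 ≤ 16 * C * J := by
    refine le_of_tendsto_of_tendsto h1 h2 ?_
    filter_upwards [h, self_mem_nhdsWithin] with r hr (hr0 : 0 < r)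
    have h4 := hr (x + r) (by simp [abs_of_pos hr0])
    rw [volume_closedBall_real_prod]
    have h5 : ENNReal.ofReal (2 * (2 * r)) ^ 2 = 16 * ENNReal.ofReal r ^ 2 := by
      rw [← mul_assoc, ENNReal.ofReal_mul (by norm_num), mul_pow]
      norm_num
    have hr1 : ENNReal.ofReal r ^ 2 ≠ 0 := by simp [hr0]
    have hr2 : ENNReal.ofReal r ^ 2 ≠ ⊤ := by finiteness
    have h6 : ‖r⁻¹ • (g (x + r) - g x)‖ₑ ^ 2 =
        edist (g x) (g (x + r)) ^ 2 / ENNReal.ofReal r ^ 2 := by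
      rw [enorm_smul, mul_pow, edist_comm, edist_eq_enorm_sub, mul_comm, div_eq_mul_inv,
        enorm_inv hr0.ne', Real.enorm_of_nonneg hr0.le, ENNReal.inv_pow]
    simp only [Function.comp_apply, h6, h5]
    calc edist (g x) (g (x + r)) ^ 2 / ENNReal.ofReal r ^ 2
        ≤ C * μ (closedBall p (2 * r)) / ENNReal.ofReal r ^ 2 := by gcongr
      _ = 16 * C * (μ (closedBall p (2 * r)) / (16 * ENNReal.ofReal r ^ 2)) := by
        rw [div_eq_mul_inv, div_eq_mul_inv, ENNReal.mul_inv (by simp) (by simp)]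
        have : (16 : ℝ≥0∞) * 16⁻¹ = 1 := ENNReal.mul_inv_cancel (by simp) (by simp)
        calc C * μ (closedBall p (2 * r)) * (ENNReal.ofReal r ^ 2)⁻¹
            = (16 * 16⁻¹) * (C * μ (closedBall p (2 * r)) * (ENNReal.ofReal r ^ 2)⁻¹) := by
              rw [this, one_mul]
          _ = _ := by ring
  calc ‖deriv g x‖ₑ = (‖deriv g x‖ₑ ^ 2) ^ (1 / 2 : ℝ) := by
        rw [← ENNReal.rpow_natCast, ← ENNReal.rpow_mul]; norm_num
    _ ≤ _ := ENNReal.rpow_le_rpow h3 (by norm_num)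

/-- On almost every horizontal line a map with the area-growth condition is absolutely continuous,
with derivative controlled by the density of the area measure. -/
lemma ae_edist_le_lintegral_horizontal {f : ℝ × ℝ → ℂ} {μ : Measure (ℝ × ℝ)} [IsFiniteMeasure μ]
    {A B : Set ℝ} (hA : A.OrdConnected) (hf : ContinuousOn f (A ×ˢ B)) {C : ℝ≥0∞} (hC : C ≠ ⊤)
    (hP : ∀ p ∈ A ×ˢ B, ∀ᶠ r in 𝓝[>] (0 : ℝ), ∀ q, dist p q ≤ r →
      edist (f p) (f q) ^ 2 ≤ C * μ (closedBall p (2 * r)))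
    {J : ℝ × ℝ → ℝ≥0∞}
    (hJ : ∀ᵐ p : ℝ × ℝ, Tendsto (fun r => μ (closedBall p r) / volume (closedBall p r))
      (𝓝[>] 0) (𝓝 (J p))) :
    ∀ᵐ y : ℝ, y ∈ B → ∀ a ∈ A, ∀ b ∈ A, a ≤ b →
      edist (f (a, y)) (f (b, y)) ≤ 2 * ∫⁻ x in Icc a b, (16 * C * J (x, y)) ^ (1 / 2 : ℝ) := by
  set κ : Measure ℝ := μ.map Prod.snd with hκ
  have hJ' : ∀ᵐ y : ℝ, ∀ᵐ x : ℝ,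
      Tendsto (fun r => μ (closedBall (x, y) r) / volume (closedBall (x, y) r))
        (𝓝[>] 0) (𝓝 (J (x, y))) := by
    have : ∀ᵐ q : ℝ × ℝ, Tendsto (fun r => μ (closedBall q.swap r) / volume (closedBall q.swap r))
        (𝓝[>] 0) (𝓝 (J q.swap)) :=
      (Measure.measurePreserving_swap (μ := (volume : Measure ℝ))
        (ν := (volume : Measure ℝ))).quasiMeasurePreserving.ae hJ
    exact Measure.ae_ae_of_ae_prod this
  filter_upwards [hJ', Besicovitch.ae_tendsto_rnDeriv κ volume, κ.rnDeriv_lt_top volume]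
    with y hy1 hy2 hy3 hyB a ha b hb hab
  have hsub : Icc a b ⊆ A := hA.out ha hb
  set ρ : ℕ → ℝ := fun n => 2 * (1 / ((n : ℝ) + 1)) with hρ
  have hδ : Tendsto (fun n : ℕ => 1 / ((n : ℝ) + 1)) atTop (𝓝[>] 0) :=
    tendsto_nhdsWithin_iff.2 ⟨tendsto_one_div_add_atTop_nhds_zero_nat,
      Eventually.of_forall fun n => by simp only [mem_Ioi]; positivity⟩
  have hρ0 : Tendsto ρ atTop (𝓝[>] 0) := by
    refine tendsto_nhdsWithin_iff.2 ⟨?_, Eventually.of_forall fun n => by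
      simp only [hρ, mem_Ioi]; positivity⟩
    simpa [hρ] using (tendsto_one_div_add_atTop_nhds_zero_nat (𝕜 := ℝ)).const_mul 2
  set m : ℕ → Measure ℝ := fun n => (μ.restrict (univ ×ˢ closedBall y (ρ n))).map Prod.fst with hm
  have hm_apply : ∀ n S, MeasurableSet S → m n S = μ (S ×ˢ closedBall y (ρ n)) := by
    intro n S hS
    rw [hm, Measure.map_apply measurable_fst hS, Measure.restrict_apply (measurable_fst hS)]
    congr 1
    ext; simp
  have hfin : liminf (fun n : ℕ => ((n : ℝ≥0∞) + 1) * m n univ) atTop ≠ ⊤ := by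
    have h1 : Tendsto (fun n => 4 * (κ (closedBall y (ρ n)) / volume (closedBall y (ρ n)))) atTop
        (𝓝 (4 * κ.rnDeriv volume y)) :=
      ENNReal.Tendsto.const_mul (hy2.comp hρ0) (Or.inr (by finiteness))
    have h2 : (fun n : ℕ => ((n : ℝ≥0∞) + 1) * m n univ) =
        fun n => 4 * (κ (closedBall y (ρ n)) / volume (closedBall y (ρ n))) := by
      ext n
      have h3 : m n univ = κ (closedBall y (ρ n)) := by
        rw [hm_apply n _ MeasurableSet.univ, hκ, Measure.map_apply measurable_snd
          measurableSet_closedBall]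
        congr 1
        ext; simp
      have h4 : ENNReal.ofReal (2 * ρ n) = 4 * ((n : ℝ≥0∞) + 1)⁻¹ := by
        rw [hρ, ← mul_assoc, ENNReal.ofReal_mul (by norm_num), one_div,
          ENNReal.ofReal_inv_of_pos (by positivity),
          ENNReal.ofReal_add (by positivity) zero_le_one]
        norm_num
      rw [h3, Real.volume_closedBall, h4, div_eq_mul_inv, ENNReal.mul_inv (by simp) (by simp),
        inv_inv]
      have : (4 : ℝ≥0∞) * 4⁻¹ = 1 := ENNReal.mul_inv_cancel (by simp) (by simp)
      calc ((n : ℝ≥0∞) + 1) * κ (closedBall y (ρ n))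
          = (4 * 4⁻¹) * (((n : ℝ≥0∞) + 1) * κ (closedBall y (ρ n))) := by rw [this, one_mul]
        _ = _ := by ring
    rw [h2, h1.liminf_eq]
    finiteness
  have key : ∀ φ : ℂ → ℝ, LipschitzWith 1 φ → edist (φ (f (a, y))) (φ (f (b, y))) ≤
      ∫⁻ x in Icc a b, (16 * C * J (x, y)) ^ (1 / 2 : ℝ) := by
    intro φ hφ
    set g : ℝ → ℝ := fun x => φ (f (x, y)) with hg
    have hgP : ∀ x ∈ Icc a b, ∀ᶠ r in 𝓝[>] (0 : ℝ), ∀ t, dist x t ≤ r →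
        edist (g x) (g t) ^ 2 ≤ C * μ (closedBall (x, y) (2 * r)) := by
      intro x hx
      filter_upwards [hP (x, y) ⟨hsub hx, hyB⟩, self_mem_nhdsWithin] with r hr (hr0 : 0 < r) t ht
      refine le_trans (pow_le_pow_left' ?_ 2) (hr (t, y) ?_)
      · simpa using hφ (f (x, y)) (f (t, y))
      · simpa [Prod.dist_eq, hr0.le] using ht
    have hgc : ContinuousOn g (Icc a b) := by
      refine hφ.continuous.comp_continuousOn (hf.comp (by fun_prop) fun x hx => ⟨hsub hx, hyB⟩)
    have hac : AbsolutelyContinuousOnInterval g a b := by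
      refine absolutelyContinuousOnInterval_of_sq_edist_le hab hgc m hC (fun x hx => ?_) hfin
      filter_upwards [hδ.eventually (hgP x hx)] with n hn t ht
      rw [hm_apply n _ measurableSet_closedBall, closedBall_prod_same]
      exact hn t ht
    have hint := hac.integral_deriv_eq_sub
    rw [intervalIntegral.integral_of_le hab] at hint
    change edist (g a) (g b) ≤ _
    rw [edist_comm, edist_eq_enorm_sub, ← hint]
    refine (enorm_integral_le_lintegral_enorm _).trans ?_
    refine (lintegral_mono_set Ioc_subset_Icc_self).trans ?_
    refine lintegral_mono_ae ((ae_restrict_iff' measurableSet_Icc).2 ?_)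
    filter_upwards [hy1] with x hx1 hx2
    exact enorm_deriv_le_of_sq_edist_le hC (hgP x hx2) hx1
  have hre := key Complex.re (by
    simpa using LipschitzWith.of_dist_le_mul (K := 1) fun z w => by
      simpa [Complex.dist_eq, Real.dist_eq] using Complex.abs_re_le_norm (z - w))
  have him := key Complex.im (by
    simpa using LipschitzWith.of_dist_le_mul (K := 1) fun z w => by
      simpa [Complex.dist_eq, Real.dist_eq] using Complex.abs_im_le_norm (z - w))
  rw [two_mul]
  refine le_trans ?_ (add_le_add hre him)
  rw [edist_dist, edist_dist, edist_dist, ← ENNReal.ofReal_add dist_nonneg dist_nonneg]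
  refine ENNReal.ofReal_le_ofReal ?_
  simpa [Complex.dist_eq, Real.dist_eq] using
    Complex.norm_le_abs_re_add_abs_im (f (a, y) - f (b, y))

lemma Complex.volume_closedEBall (a : ℂ) (r : ℝ≥0∞) :
    volume (closedEBall a r) = NNReal.pi * r ^ 2 := by
  rcases eq_or_ne r ⊤ with rfl | hr
  · simp [ENNReal.mul_top, NNReal.pi_ne_zero]
  · lift r to ℝ≥0 using hr
    rw [closedEBall_coe, Complex.volume_closedBall, ENNReal.ofReal_coe_nnreal, mul_comm]

/-- A continuous open map into the plane sends a compact set into any closed ball containing the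
image of its boundary. -/
lemma image_subset_closedEBall_of_isOpenMap {X : Type*} [TopologicalSpace X] {f : X → ℂ}
    {K O : Set X} (hK : IsCompact K) (hf : ContinuousOn f K) (hO : IsOpen (f '' O)) (hOK : O ⊆ K)
    {w : ℂ} {R : ℝ≥0∞} (h : ∀ q ∈ K \ O, edist (f q) w ≤ R) :
    f '' K ⊆ closedEBall w R := by
  rcases K.eq_empty_or_nonempty with rfl | hne
  · simp
  obtain ⟨q, hq, hmax⟩ := hK.exists_isMaxOn hne
    ((continuous_id.dist continuous_const : Continuous fun z => dist z w).comp_continuousOn hf)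
  have hqO : q ∉ O := by
    intro hqO
    have hsub : f '' O ⊆ closedBall w (dist (f q) w) := by
      rintro _ ⟨z, hz, rfl⟩
      exact hmax (hOK hz)
    have := interior_maximal hsub hO (mem_image_of_mem f hqO)
    rw [interior_closedBall'] at this
    exact lt_irrefl _ (mem_ball.1 this)
  rintro _ ⟨z, hz, rfl⟩
  refine le_trans ?_ (h q ⟨hq, hqO⟩)
  rw [edist_dist, edist_dist]
  exact ENNReal.ofReal_le_ofReal (hmax hz)

/-- Length-area estimate on squares: if `G` bounds the variation of `f` on almost every
horizontal and vertical line, then the area of the image of a square is controlled by the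
`L²`-norm of `G` on the doubled square. -/
lemma volume_image_closedBall_le_lintegral_sq {f : ℝ × ℝ → ℂ} {A B : Set ℝ}
    (hf : ContinuousOn f (A ×ˢ B))
    (hopen : ∀ O ⊆ A ×ˢ B, IsOpen O → IsOpen (f '' O))
    {G : ℝ × ℝ → ℝ≥0∞} (hG : Measurable G)
    (hH : ∀ᵐ y : ℝ, y ∈ B → ∀ a ∈ A, ∀ b ∈ A, a ≤ b →
      edist (f (a, y)) (f (b, y)) ≤ ∫⁻ x in Icc a b, G (x, y))
    (hV : ∀ᵐ x : ℝ, x ∈ A → ∀ a ∈ B, ∀ b ∈ B, a ≤ b →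
      edist (f (x, a)) (f (x, b)) ≤ ∫⁻ y in Icc a b, G (x, y))
    {p : ℝ × ℝ} {s : ℝ} (hs : 0 < s) (hp : closedBall p (2 * s) ⊆ A ×ˢ B) :
    volume (f '' closedBall p s) ≤
      256 * NNReal.pi * ∫⁻ q in closedBall p (2 * s), G q ^ 2 := by
  obtain ⟨x₀, y₀⟩ := p
  set I := Icc (x₀ - 2 * s) (x₀ + 2 * s) with hI
  set I' := Icc (y₀ - 2 * s) (y₀ + 2 * s) with hI'
  have hQ : closedBall (x₀, y₀) (2 * s) = I ×ˢ I' := by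
    rw [← closedBall_prod_same, Real.closedBall_eq_Icc, Real.closedBall_eq_Icc]
  rw [hQ] at hp
  have hIA : I ⊆ A := fun x hx =>
    (hp (⟨hx, by constructor <;> linarith⟩ : (x, y₀) ∈ I ×ˢ I')).1
  have hIB : I' ⊆ B := fun y hy =>
    (hp (⟨by constructor <;> linarith, hy⟩ : (x₀, y) ∈ I ×ˢ I')).2
  rw [← hQ] at hp
  set Φ : ℝ → ℝ≥0∞ := fun y => ∫⁻ x in I, G (x, y) with hΦ
  set Ψ : ℝ → ℝ≥0∞ := fun x => ∫⁻ y in I', G (x, y) with hΨ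
  have hΦm : Measurable Φ := Measurable.lintegral_prod_left' hG
  have hΨm : Measurable Ψ := Measurable.lintegral_prod_right' hG
  have hH' : ∀ᵐ y : ℝ, y ∈ I' → ∀ a ∈ I, ∀ b ∈ I, edist (f (a, y)) (f (b, y)) ≤ Φ y := by
    filter_upwards [hH] with y hy hyI a ha b hb
    rcases le_total a b with hab | hab
    · exact (hy (hIB hyI) a (hIA ha) b (hIA hb) hab).trans
        (lintegral_mono_set (Icc_subset_Icc ha.1 hb.2))
    · rw [edist_comm]
      exact (hy (hIB hyI) b (hIA hb) a (hIA ha) hab).trans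
        (lintegral_mono_set (Icc_subset_Icc hb.1 ha.2))
  have hV' : ∀ᵐ x : ℝ, x ∈ I → ∀ a ∈ I', ∀ b ∈ I', edist (f (x, a)) (f (x, b)) ≤ Ψ x := by
    filter_upwards [hV] with x hx hxI a ha b hb
    rcases le_total a b with hab | hab
    · exact (hx (hIA hxI) a (hIB ha) b (hIB hb) hab).trans
        (lintegral_mono_set (Icc_subset_Icc ha.1 hb.2))
    · rw [edist_comm]
      exact (hx (hIA hxI) b (hIB hb) a (hIB ha) hab).trans
        (lintegral_mono_set (Icc_subset_Icc hb.1 ha.2))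
  set T := Ioc s (2 * s) with hT
  set Λ : ℝ → ℝ≥0∞ := fun t => Φ (y₀ - t) + Φ (y₀ + t) + (Ψ (x₀ - t) + Ψ (x₀ + t)) with hΛ
  have hsub : ∀ c : ℝ, MeasurePreserving (fun t : ℝ => c - t) volume volume :=
    fun c => Measure.measurePreserving_sub_left volume c
  have hadd : ∀ c : ℝ, MeasurePreserving (fun t : ℝ => c + t) volume volume :=
    fun c => measurePreserving_add_left volume c
  have hpt : ∀ᵐ t : ℝ, t ∈ T →
      volume (f '' closedBall (x₀, y₀) s) ≤ NNReal.pi * Λ t ^ 2 := by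
    filter_upwards [(hsub y₀).quasiMeasurePreserving.ae hH',
      (hadd y₀).quasiMeasurePreserving.ae hH', (hsub x₀).quasiMeasurePreserving.ae hV',
      (hadd x₀).quasiMeasurePreserving.ae hV'] with t h1 h2 h3 h4 ht
    have ht0 : 0 < t := hs.trans ht.1
    have hx1 : x₀ - t ∈ I := ⟨by linarith [ht.2], by linarith⟩
    have hx2 : x₀ + t ∈ I := ⟨by linarith, by linarith [ht.2]⟩
    have hy1 : y₀ - t ∈ I' := ⟨by linarith [ht.2], by linarith⟩
    have hy2 : y₀ + t ∈ I' := ⟨by linarith, by linarith [ht.2]⟩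
    replace h1 := h1 hy1
    replace h2 := h2 hy2
    replace h3 := h3 hx1
    replace h4 := h4 hx2
    have hKU : closedBall (x₀, y₀) t ⊆ A ×ˢ B := (closedBall_subset_closedBall ht.2).trans hp
    have hcov : f '' closedBall (x₀, y₀) t ⊆ closedEBall (f (x₀ - t, y₀ - t)) (Λ t) := by
      refine image_subset_closedEBall_of_isOpenMap (isCompact_closedBall _ _) (hf.mono hKU)
        (hopen _ (ball_subset_closedBall.trans hKU) isOpen_ball) ball_subset_closedBall ?_
      rintro ⟨x, y⟩ ⟨hq1, hq2⟩
      have hq3 : x ∈ I ∧ y ∈ I' := by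
        have := closedBall_subset_closedBall ht.2 hq1
        rwa [hQ] at this
      rw [mem_closedBall, Prod.dist_eq, max_le_iff] at hq1
      rw [mem_ball, Prod.dist_eq, max_lt_iff, not_and_or, not_lt, not_lt] at hq2
      simp only [Real.dist_eq] at hq1 hq2
      rcases hq2 with hq2 | hq2
      · have : x = x₀ - t ∨ x = x₀ + t := by
          rcases abs_eq ht0.le |>.1 (le_antisymm hq1.1 hq2) with h | h
          · right; linarith
          · left; linarith
        rcases this with rfl | rfl
        · refine (h3 _ hq3.2 _ hy1).trans ?_
          simp only [hΛ]
          exact le_add_left le_self_add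
        · refine (edist_triangle _ (f (x₀ + t, y₀ - t)) _).trans ?_
          refine (add_le_add (h4 _ hq3.2 _ hy1) (h1 _ hx2 _ hx1)).trans ?_
          simp only [hΛ]
          rw [add_comm]
          exact add_le_add le_self_add le_add_self
      · have : y = y₀ - t ∨ y = y₀ + t := by
          rcases abs_eq ht0.le |>.1 (le_antisymm hq1.2 hq2) with h | h
          · right; linarith
          · left; linarith
        rcases this with rfl | rfl
        · refine (h1 _ hq3.1 _ hx1).trans ?_
          simp only [hΛ]
          exact le_self_add.trans le_self_add
        · refine (edist_triangle _ (f (x₀ - t, y₀ + t)) _).trans ?_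
          refine (add_le_add (h2 _ hq3.1 _ hx1) (h3 _ hy2 _ hy1)).trans ?_
          simp only [hΛ]
          exact add_le_add le_add_self le_self_add
    calc volume (f '' closedBall (x₀, y₀) s)
        ≤ volume (closedEBall (f (x₀ - t, y₀ - t)) (Λ t)) :=
          measure_mono ((image_mono (closedBall_subset_closedBall ht.1.le)).trans hcov)
      _ = NNReal.pi * Λ t ^ 2 := Complex.volume_closedEBall _ _
  have hTI : ∀ {h : ℝ → ℝ≥0∞} (φ : ℝ → ℝ) (a b : ℝ), Measurable h →
      MeasurePreserving φ volume volume → MapsTo φ T (Icc a b) →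
      ∫⁻ t in T, h (φ t) ≤ ∫⁻ y in Icc a b, h y := by
    intro h φ a b hh hφ hmaps
    rw [← hφ.setLIntegral_comp_preimage measurableSet_Icc hh]
    exact lintegral_mono_set hmaps
  have hswap : ∫⁻ q in closedBall (x₀, y₀) (2 * s), G q = ∫⁻ x in I, Ψ x := by
    rw [hQ, Measure.volume_eq_prod, ← Measure.prod_restrict, lintegral_prod _ hG.aemeasurable]
  have hswap' : ∫⁻ q in closedBall (x₀, y₀) (2 * s), G q = ∫⁻ y in I', Φ y := by
    rw [hQ, Measure.volume_eq_prod, ← Measure.prod_restrict,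
      lintegral_prod_symm _ hG.aemeasurable]
  set D := ∫⁻ q in closedBall (x₀, y₀) (2 * s), G q with hD
  have hint : ∫⁻ t in T, Λ t ≤ 4 * D := by
    have e1 : ∫⁻ t in T, Φ (y₀ - t) ≤ D := hswap' ▸ hTI _ _ _ hΦm (hsub y₀)
      fun t ht => ⟨by linarith [ht.2], by linarith [ht.1]⟩
    have e2 : ∫⁻ t in T, Φ (y₀ + t) ≤ D := hswap' ▸ hTI _ _ _ hΦm (hadd y₀)
      fun t ht => ⟨by linarith [ht.1], by linarith [ht.2]⟩
    have e3 : ∫⁻ t in T, Ψ (x₀ - t) ≤ D := hswap ▸ hTI _ _ _ hΨm (hsub x₀)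
      fun t ht => ⟨by linarith [ht.2], by linarith [ht.1]⟩
    have e4 : ∫⁻ t in T, Ψ (x₀ + t) ≤ D := hswap ▸ hTI _ _ _ hΨm (hadd x₀)
      fun t ht => ⟨by linarith [ht.1], by linarith [ht.2]⟩
    simp only [hΛ]
    rw [lintegral_add_left (by fun_prop), lintegral_add_left (by fun_prop),
      lintegral_add_left (by fun_prop)]
    calc _ ≤ D + D + (D + D) := by gcongr
      _ = _ := by ring
  have hpi : (NNReal.pi : ℝ≥0∞) ≠ 0 := by simp [NNReal.pi_ne_zero]
  set M := volume (f '' closedBall (x₀, y₀) s) with hM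
  have hroot : ENNReal.ofReal s * (M / NNReal.pi) ^ (1 / 2 : ℝ) ≤ 4 * D := by
    calc ENNReal.ofReal s * (M / NNReal.pi) ^ (1 / 2 : ℝ)
        = ∫⁻ t in T, (M / NNReal.pi) ^ (1 / 2 : ℝ) := by
          rw [setLIntegral_const, hT, Real.volume_Ioc, mul_comm]
          congr 2; ring
      _ ≤ ∫⁻ t in T, Λ t := by
          refine lintegral_mono_ae ((ae_restrict_iff' measurableSet_Ioc).2 ?_)
          filter_upwards [hpt] with t ht htT
          calc (M / NNReal.pi) ^ (1 / 2 : ℝ) ≤ (Λ t ^ 2) ^ (1 / 2 : ℝ) := by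
                refine ENNReal.rpow_le_rpow (ENNReal.div_le_of_le_mul' (ht htT)) (by norm_num)
            _ = Λ t := by rw [← ENNReal.rpow_natCast, ← ENNReal.rpow_mul]; norm_num
      _ ≤ 4 * D := hint
  have hsqr : ENNReal.ofReal s ^ 2 * (M / NNReal.pi) ≤
      ENNReal.ofReal s ^ 2 * (256 * ∫⁻ q in closedBall (x₀, y₀) (2 * s), G q ^ 2) := by
    calc ENNReal.ofReal s ^ 2 * (M / NNReal.pi)
        = (ENNReal.ofReal s * (M / NNReal.pi) ^ (1 / 2 : ℝ)) ^ 2 := by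
          rw [mul_pow]; congr 1; rw [← ENNReal.rpow_natCast, ← ENNReal.rpow_mul]; norm_num
      _ ≤ (4 * D) ^ 2 := by gcongr
      _ = 16 * D ^ 2 := by rw [mul_pow]; norm_num
      _ ≤ 16 * (volume (closedBall (x₀, y₀) (2 * s)) *
            ∫⁻ q in closedBall (x₀, y₀) (2 * s), G q ^ 2) := by
          gcongr
          simpa using sq_lintegral_le (volume.restrict (closedBall (x₀, y₀) (2 * s)))
            hG.aemeasurable
      _ = _ := by
          rw [volume_closedBall_real_prod, ← mul_assoc 2 2 s, ENNReal.ofReal_mul (by norm_num),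
            mul_pow, ← mul_assoc, ← mul_assoc, ← mul_assoc]
          norm_num
          ring
  have hs2 : ENNReal.ofReal s ^ 2 ≠ 0 := by simp [hs]
  have := (ENNReal.mul_le_mul_iff_right hs2 (by finiteness)).1 hsqr
  rw [ENNReal.div_le_iff hpi (by simp)] at this
  exact this.trans_eq (by ring)

lemma lintegral_measure_closedBall_real_prod (ρ : Measure (ℝ × ℝ)) [SFinite ρ] (r : ℝ) :
    ∫⁻ x, ρ (closedBall x r) = ENNReal.ofReal (2 * r) ^ 2 * ρ univ := by
  have hm : MeasurableSet {z : (ℝ × ℝ) × (ℝ × ℝ) | dist z.2 z.1 ≤ r} :=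
    measurableSet_le (by fun_prop) measurable_const
  have h1 := Measure.prod_apply (μ := (volume : Measure (ℝ × ℝ))) (ν := ρ) hm
  have h2 := Measure.prod_apply_symm (μ := (volume : Measure (ℝ × ℝ))) (ν := ρ) hm
  have h3 : ∀ y : ℝ × ℝ, (fun x => (x, y)) ⁻¹' {z : (ℝ × ℝ) × (ℝ × ℝ) | dist z.2 z.1 ≤ r} =
      closedBall y r := by
    intro y; ext x; simp [dist_comm]
  simp only [h3, volume_closedBall_real_prod, lintegral_const] at h2
  rw [← h2, h1]
  rfl

/-- If the mass of squares for `μ` is controlled by the mass of the doubled squares for a finite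
absolutely continuous measure, then `μ` does not charge compact null sets. -/
lemma measure_compact_eq_zero_of_closedBall_le {μ ν : Measure (ℝ × ℝ)} [IsFiniteMeasure μ]
    [IsFiniteMeasure ν] (hν : ν ≪ volume) {U : Set (ℝ × ℝ)} (hU : IsOpen U) {C : ℝ≥0∞}
    (hC : C ≠ ⊤)
    (h : ∀ p s, 0 < s → closedBall p (2 * s) ⊆ U →
      μ (closedBall p s) ≤ C * ν (closedBall p (2 * s)))
    {K : Set (ℝ × ℝ)} (hK : IsCompact K) (hKU : K ⊆ U) (hK0 : volume K = 0) : μ K = 0 := by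
  obtain ⟨δ, hδ, hδU⟩ := hK.exists_cthickening_subset_open hU hKU
  have hlim : Tendsto (fun r : ℝ => 4 * C * ν (cthickening (3 * r) K)) (𝓝[>] 0) (𝓝 0) := by
    have h0 : Tendsto (fun r : ℝ => 3 * r) (𝓝[>] 0) (𝓝 0) :=
      (tendsto_const_mul_nhdsGT_zero three_pos).mono_right nhdsWithin_le_nhds
    have := ENNReal.Tendsto.const_mul (a := 4 * C)
      ((tendsto_measure_cthickening_of_isCompact (μ := ν) hK).comp h0) (Or.inr (by finiteness))
    simpa [hν hK0, Function.comp_def] using this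
  refine le_antisymm (ge_of_tendsto hlim ?_) zero_le
  have hev : ∀ᶠ r : ℝ in 𝓝[>] 0, r < δ / 3 :=
    nhdsWithin_le_nhds (eventually_lt_nhds (by positivity))
  filter_upwards [hev, self_mem_nhdsWithin] with r hr (hr0 : 0 < r)
  have h1 := lintegral_measure_closedBall_real_prod (μ.restrict K) r
  have h2 := lintegral_measure_closedBall_real_prod (ν.restrict (cthickening (3 * r) K)) (2 * r)
  rw [Measure.restrict_apply_univ] at h1 h2
  have h3 : ∀ x, μ.restrict K (closedBall x r) ≤
      C * ν.restrict (cthickening (3 * r) K) (closedBall x (2 * r)) := by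
    intro x
    rw [Measure.restrict_apply measurableSet_closedBall,
      Measure.restrict_apply measurableSet_closedBall]
    rcases (closedBall x r ∩ K).eq_empty_or_nonempty with he | ⟨z, hz1, hz2⟩
    · simp [he]
    have hsub : closedBall x (2 * r) ⊆ cthickening (3 * r) K := by
      intro w hw
      refine mem_cthickening_of_dist_le w z _ _ hz2 ?_
      have := dist_triangle_right w z x
      rw [mem_closedBall] at hw hz1
      linarith
    rw [inter_eq_left.2 hsub]
    refine (measure_mono inter_subset_left).trans (h x r hr0 (hsub.trans ?_))
    exact (cthickening_mono (by linarith) _).trans hδU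
  have h4 : ENNReal.ofReal (2 * r) ^ 2 * μ K ≤
      ENNReal.ofReal (2 * r) ^ 2 * (4 * C * ν (cthickening (3 * r) K)) := by
    rw [← h1]
    calc ∫⁻ x, μ.restrict K (closedBall x r)
        ≤ ∫⁻ x, C * ν.restrict (cthickening (3 * r) K) (closedBall x (2 * r)) := lintegral_mono h3
      _ = _ := by
        rw [lintegral_const_mul' _ _ hC, h2, ENNReal.ofReal_mul (p := 2) (q := 2 * r) zero_le_two,
          mul_pow]
        norm_num
        ring
  have hr2 : ENNReal.ofReal (2 * r) ^ 2 ≠ 0 := by simp [hr0]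
  exact (ENNReal.mul_le_mul_iff_right hr2 (by finiteness)).1 h4

/-- A continuous open map on a rectangle whose area measure controls its local oscillation sends
null sets to null sets. -/
lemma volume_image_eq_zero_of_sq_edist_le {f : ℝ × ℝ → ℂ} {A B : Set ℝ} (hA : A.OrdConnected)
    (hB : B.OrdConnected) (hAB : IsOpen (A ×ˢ B)) (hf : ContinuousOn f (A ×ˢ B))
    (hopen : ∀ O ⊆ A ×ˢ B, IsOpen O → IsOpen (f '' O)) {μ : Measure (ℝ × ℝ)} [IsFiniteMeasure μ]
    (hμ : ∀ S ⊆ A ×ˢ B, μ S = volume (f '' S)) {C : ℝ≥0∞} (hC : C ≠ ⊤)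
    (hP : ∀ p ∈ A ×ˢ B, ∀ᶠ r in 𝓝[>] (0 : ℝ), ∀ q, dist p q ≤ r →
      edist (f p) (f q) ^ 2 ≤ C * μ (closedBall p (2 * r)))
    {E : Set (ℝ × ℝ)} (hE : E ⊆ A ×ˢ B) (hE0 : volume E = 0) : volume (f '' E) = 0 := by
  set J := μ.rnDeriv volume with hJdef
  have hJm : Measurable J := Measure.measurable_rnDeriv _ _
  have hJ : ∀ᵐ p : ℝ × ℝ, Tendsto (fun r => μ (closedBall p r) / volume (closedBall p r))
      (𝓝[>] 0) (𝓝 (J p)) := Besicovitch.ae_tendsto_rnDeriv μ volume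
  set G : ℝ × ℝ → ℝ≥0∞ := fun p => 2 * (16 * C * J p) ^ (1 / 2 : ℝ) with hGdef
  have hG : Measurable G := by fun_prop
  have hH := ae_edist_le_lintegral_horizontal hA hf hC hP hJ
  have hswap_ball : ∀ (p : ℝ × ℝ) r, Prod.swap ⁻¹' closedBall p r = closedBall p.swap r := by
    rintro ⟨x, y⟩ r
    ext ⟨a, b⟩
    simp [Prod.dist_eq, and_comm]
  have hmap : ∀ (p : ℝ × ℝ) r, μ.map Prod.swap (closedBall p r) = μ (closedBall p.swap r) := by
    intro p r
    rw [Measure.map_apply measurable_swap measurableSet_closedBall, hswap_ball]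
  have hV := ae_edist_le_lintegral_horizontal (f := f ∘ Prod.swap) (μ := μ.map Prod.swap)
    (A := B) (B := A) (J := J ∘ Prod.swap) hB
    (hf.comp continuous_swap.continuousOn fun p hp => ⟨hp.2, hp.1⟩) hC
    (fun p hp => by
      filter_upwards [hP p.swap ⟨hp.2, hp.1⟩] with r hr q hq
      rw [hmap]
      refine hr q.swap ?_
      simpa [Prod.dist_eq, max_comm] using hq)
    (by
      have : ∀ᵐ q : ℝ × ℝ, Tendsto
          (fun r => μ (closedBall q.swap r) / volume (closedBall q.swap r))
          (𝓝[>] 0) (𝓝 (J q.swap)) :=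
        (Measure.measurePreserving_swap (μ := (volume : Measure ℝ))
          (ν := (volume : Measure ℝ))).quasiMeasurePreserving.ae hJ
      filter_upwards [this] with q hq
      simpa only [hmap, volume_closedBall_real_prod, Function.comp_apply] using hq)
  have h2 : (2 : ℝ≥0∞) ≠ ⊤ := by simp
  simp only [Function.comp_apply, Prod.swap_prod_mk, ← lintegral_const_mul' _ _ h2] at hH hV
  set ν := (volume : Measure (ℝ × ℝ)).withDensity J with hν
  have : IsFiniteMeasure ν := ⟨(Measure.withDensity_rnDeriv_le μ volume univ).trans_lt
    (measure_lt_top μ univ)⟩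
  have hsq : ∀ q, G q ^ 2 = 64 * C * J q := by
    intro q
    simp only [hGdef]
    rw [mul_pow, ← ENNReal.rpow_natCast (_ ^ _), ← ENNReal.rpow_mul]
    norm_num
    ring
  have hC' : 256 * NNReal.pi * (64 * C) ≠ ⊤ := by finiteness
  have hball : ∀ p s, 0 < s → closedBall p (2 * s) ⊆ A ×ˢ B →
      μ (closedBall p s) ≤ 256 * NNReal.pi * (64 * C) * ν (closedBall p (2 * s)) := by
    intro p s hs hp
    rw [hμ _ ((closedBall_subset_closedBall (by linarith)).trans hp)]
    refine (volume_image_closedBall_le_lintegral_sq hf hopen hG hH hV hs hp).trans_eq ?_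
    simp only [hsq]
    rw [lintegral_const_mul' _ _ (by finiteness), hν, withDensity_apply _ measurableSet_closedBall]
    ring
  set N := toMeasurable volume E ∩ A ×ˢ B with hN
  have hN0 : volume N = 0 :=
    measure_mono_null inter_subset_left ((measure_toMeasurable E).trans hE0)
  have hNm : MeasurableSet N := (measurableSet_toMeasurable _ _).inter hAB.measurableSet
  have hμN : μ N = 0 := by
    rw [hNm.measure_eq_iSup_isCompact]
    simp only [ENNReal.iSup_eq_zero]
    exact fun K hKN hK => measure_compact_eq_zero_of_closedBall_le
      (withDensity_absolutelyContinuous _ _) hAB hC' hball hK (hKN.trans inter_subset_right)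
      (measure_mono_null hKN hN0)
  rw [hμ N inter_subset_right] at hμN
  exact measure_mono_null (image_mono (subset_inter (subset_toMeasurable _ _) hE)) hμN

/-- The measure `S ↦ volume (F '' (S ∩ Ω))`, for `F` injective on `Ω`. -/
def imageMeasure (F : ℂ → ℂ) (Ω : Set ℂ) : Measure ℂ :=
  (volume.comap (Ω.domRestrict F)).map Subtype.val

lemma IsHomeoOn.isOpenEmbedding {F : ℂ → ℂ} {Ω V : Set ℂ} (hV : IsOpen V)
    (h : IsHomeoOn F Ω V) : Topology.IsOpenEmbedding (Ω.domRestrict F) := by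
  obtain ⟨e, he⟩ := h
  have : Ω.domRestrict F = Subtype.val ∘ e := funext fun z => (he z).symm
  rw [this]
  exact hV.isOpenEmbedding_subtypeVal.comp e.isOpenEmbedding

lemma imageMeasure_apply {F : ℂ → ℂ} {Ω : Set ℂ} (hΩ : IsOpen Ω)
    (hF : Topology.IsOpenEmbedding (Ω.domRestrict F)) (S : Set ℂ) :
    imageMeasure F Ω S = volume (F '' (S ∩ Ω)) := by
  rw [imageMeasure, (MeasurableEmbedding.subtype_coe hΩ.measurableSet).map_apply,
    hF.measurableEmbedding.comap_apply]
  congr 1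
  ext w
  simp [and_assoc]

lemma imageMeasure_lt_top_of_isCompact {F : ℂ → ℂ} {Ω : Set ℂ} (hΩ : IsOpen Ω)
    (hF : Topology.IsOpenEmbedding (Ω.domRestrict F)) {K : Set ℂ} (hK : IsCompact K) (hKΩ : K ⊆ Ω) :
    imageMeasure F Ω K < ⊤ := by
  rw [imageMeasure_apply hΩ hF, inter_eq_left.2 hKΩ]
  exact (hK.image_of_continuousOn
    ((continuousOn_iff_continuous_domRestrict.2 hF.continuous).mono hKΩ)).measure_lt_top

/-- Bounded dilatation at a point: the area of the image of a small disc controls the oscillation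
of the map on that disc. -/
lemma eventually_sq_edist_le_imageMeasure {F : ℂ → ℂ} {Ω : Set ℂ} (hΩ : IsOpen Ω)
    (hF : Topology.IsOpenEmbedding (Ω.domRestrict F)) {p : ℂ} (hp : p ∈ Ω) {H : ℝ≥0∞} (hH : H < ⊤)
    (hd : dilatationOn F Ω p ≤ H) :
    ∀ᶠ r in 𝓝[>] (0 : ℝ), ∀ q ∈ Ω, dist p q ≤ r →
      edist (F p) (F q) ^ 2 ≤ (H + 1) ^ 2 * imageMeasure F Ω (closedBall p r) := by
  have hVn : F '' Ω ∈ 𝓝 (F p) := by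
    have := hF.isOpen_range
    rw [range_domRestrict] at this
    exact this.mem_nhds (mem_image_of_mem F hp)
  obtain ⟨ε₀, hε₀, hεV⟩ := Metric.mem_nhds_iff.1 hVn
  set ε := ENNReal.ofReal ε₀ with hεdef
  have hε : 0 < ε := ENNReal.ofReal_pos.2 hε₀
  have hε' : ε < ⊤ := ENNReal.ofReal_lt_top
  rw [← eball_ofReal, ← hεdef] at hεV
  have hcont : ContinuousAt F p :=
    (continuousOn_iff_continuous_domRestrict.2 hF.continuous).continuousAt (hΩ.mem_nhds hp)
  obtain ⟨δ, hδ, hδε⟩ := Metric.mem_nhds_iff.1 (hcont (eball_mem_nhds _ hε))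
  have hev : ∀ᶠ r : ℝ in 𝓝[>] 0, r < δ := nhdsWithin_le_nhds (eventually_lt_nhds hδ)
  have hlim : ∀ᶠ r : ℝ in 𝓝[>] 0, supDistImage F Ω p r / infDistImage F Ω p r < H + 1 :=
    eventually_lt_of_limsup_lt (hd.trans_lt (ENNReal.lt_add_right hH.ne one_ne_zero))
  filter_upwards [hev, hlim] with r hr hr' q hq hpq
  set l := infDistImage F Ω p r with hl
  have h1 : edist (F p) (F q) ≤ (H + 1) * l := by
    refine le_trans ?_ ((ENNReal.div_le_iff_le_mul (Or.inr (by finiteness))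
      (Or.inr (by simp))).1 hr'.le)
    exact le_iSup₂_of_le q ⟨hq, hpq⟩ le_rfl
  have h2 : edist (F p) (F q) ≤ (H + 1) * ε := by
    have : edist (F q) (F p) < ε := hδε (by rw [mem_ball']; linarith)
    rw [edist_comm]
    exact this.le.trans (le_mul_of_one_le_left zero_le le_add_self)
  have h3 : edist (F p) (F q) ≤ (H + 1) * min l ε := by
    rcases min_choice l ε with h | h <;> rw [h] <;> assumption
  have hball : eball (F p) (min l ε) ⊆ F '' (closedBall p r ∩ Ω) := by
    intro z hz
    obtain ⟨w, hw, rfl⟩ := hεV (eball_subset_eball (min_le_right _ _) hz)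
    refine ⟨w, ⟨?_, hw⟩, rfl⟩
    by_contra hwr
    rw [mem_closedBall', not_le] at hwr
    have h4 : l ≤ edist (F p) (F w) := iInf₂_le w ⟨hw, hwr.le⟩
    have h5 : edist (F w) (F p) < l := lt_of_lt_of_le hz (min_le_left _ _)
    rw [edist_comm] at h5
    exact h5.not_ge h4
  have hm : min l ε ≠ ⊤ := (min_lt_of_right_lt hε').ne
  have hvol : min l ε ^ 2 ≤ imageMeasure F Ω (closedBall p r) := by
    rw [imageMeasure_apply hΩ hF]
    refine le_trans ?_ (measure_mono hball)
    generalize min l ε = m at hm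
    lift m to ℝ≥0 using hm
    rw [eball_coe, Complex.volume_ball, ENNReal.ofReal_coe_nnreal]
    refine le_mul_of_one_le_right zero_le ?_
    exact_mod_cast (one_le_two.trans Real.two_le_pi : (1 : ℝ) ≤ NNReal.pi)
  calc edist (F p) (F q) ^ 2 ≤ ((H + 1) * min l ε) ^ 2 := by gcongr
    _ = (H + 1) ^ 2 * min l ε ^ 2 := mul_pow _ _ _
    _ ≤ _ := by gcongr

/-- Maps of bounded dilatation send null sets to null sets. -/
lemma imageMeasure_absolutelyContinuous {F : ℂ → ℂ} {Ω : Set ℂ} (hΩ : IsOpen Ω)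
    (hF : Topology.IsOpenEmbedding (Ω.domRestrict F)) {H : ℝ≥0∞} (hH : H < ⊤)
    (hd : ∀ w ∈ Ω, dilatationOn F Ω w ≤ H) {E : Set ℂ} (hE : E ⊆ Ω) (hE0 : volume E = 0) :
    imageMeasure F Ω E = 0 := by
  refine measure_null_of_locally_null E fun p hp => ?_
  obtain ⟨R, hR, hRΩ⟩ := Metric.nhds_basis_closedBall.mem_iff.1 (hΩ.mem_nhds (hE hp))
  set e := Complex.measurableEquivRealProd.symm with he
  have he1 : ∀ a b, dist (e a) (e b) ≤ 2 * dist a b := by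
    intro a b
    have h1 := Complex.norm_le_abs_re_add_abs_im (e a - e b)
    have h2 : |a.1 - b.1| ≤ dist a b := le_max_left _ _
    have h3 : |a.2 - b.2| ≤ dist a b := le_max_right _ _
    change ‖e a - e b‖ ≤ |a.1 - b.1| + |a.2 - b.2| at h1
    rw [Complex.dist_eq]
    linarith
  have he2 : ∀ a b, dist (e.symm a) (e.symm b) ≤ dist a b := by
    intro a b
    have h1 := Complex.abs_re_le_norm (a - b)
    have h2 := Complex.abs_im_le_norm (a - b)
    rw [← Complex.dist_eq] at h1 h2
    exact max_le h1 h2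
  have hec : Continuous e := Complex.equivRealProdCLM.symm.continuous
  have hec' : Continuous e.symm := Complex.equivRealProdCLM.continuous
  have hev : MeasurePreserving e volume volume :=
    Complex.volume_preserving_equiv_real_prod.symm
  set Q := ball (e.symm p) (R / 2) with hQ
  have hQR : ∀ a ∈ Q, e a ∈ closedBall p R := by
    intro a ha
    have := he1 a (e.symm p)
    rw [MeasurableEquiv.apply_symm_apply] at this
    rw [hQ, mem_ball] at ha
    rw [mem_closedBall]
    linarith
  have hQΩ : MapsTo e Q Ω := fun a ha => hRΩ (hQR a ha)
  have hFc : ContinuousOn F Ω := continuousOn_iff_continuous_domRestrict.2 hF.continuous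
  set μ := ((imageMeasure F Ω).restrict (closedBall p R)).map e.symm with hμ
  have : IsFiniteMeasure ((imageMeasure F Ω).restrict (closedBall p R)) :=
    ⟨by simpa using imageMeasure_lt_top_of_isCompact hΩ hF (isCompact_closedBall p R) hRΩ⟩
  have hμ_apply : ∀ S, μ S = imageMeasure F Ω (e.symm ⁻¹' S ∩ closedBall p R) := by
    intro S
    rw [hμ, MeasurableEquiv.map_apply, Measure.restrict_apply' measurableSet_closedBall]
  have hQprod : ball (e.symm p).1 (R / 2) ×ˢ ball (e.symm p).2 (R / 2) = Q :=
    ball_prod_same _ _ _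
  have hnull := volume_image_eq_zero_of_sq_edist_le (f := F ∘ e)
    (A := ball (e.symm p).1 (R / 2)) (B := ball (e.symm p).2 (R / 2)) (μ := μ)
    (C := (H + 1) ^ 2) (E := Q ∩ e ⁻¹' E)
    (by rw [Real.ball_eq_Ioo]; exact ordConnected_Ioo)
    (by rw [Real.ball_eq_Ioo]; exact ordConnected_Ioo) (by rw [hQprod]; exact isOpen_ball)
    (by rw [hQprod]; exact hFc.comp hec.continuousOn hQΩ)
    (by
      rw [hQprod]
      intro O hO hOo
      have h1 : IsOpen (Subtype.val ⁻¹' (e.symm ⁻¹' O) : Set Ω) :=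
        (hOo.preimage hec').preimage continuous_subtype_val
      have h2 := hF.isOpenMap _ h1
      convert h2 using 1
      ext w
      constructor
      · rintro ⟨a, ha, rfl⟩
        exact ⟨⟨e a, hQΩ (hO ha)⟩, by simpa using ha, rfl⟩
      · rintro ⟨⟨z, hz⟩, hza, rfl⟩
        exact ⟨e.symm z, hza, by simp⟩)
    (by
      rw [hQprod]
      intro S hS
      rw [hμ_apply, imageMeasure_apply hΩ hF]
      congr 1
      ext w
      constructor
      · rintro ⟨z, ⟨⟨hz1, hz2⟩, hz3⟩, rfl⟩
        exact ⟨e.symm z, hz1, by simp⟩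
      · rintro ⟨a, ha, rfl⟩
        exact ⟨e a, ⟨⟨by simpa using ha, hQR a (hS ha)⟩, hQΩ (hS ha)⟩, rfl⟩)
    (by finiteness)
    (by
      rw [hQprod]
      intro a ha
      have htwo := tendsto_const_mul_nhdsGT_zero two_pos
      have hsub : ∀ᶠ r in 𝓝[>] (0 : ℝ), closedBall a r ⊆ Q :=
        nhdsWithin_le_nhds (eventually_closedBall_subset (isOpen_ball.mem_nhds ha))
      filter_upwards [htwo.eventually (eventually_sq_edist_le_imageMeasure hΩ hF (hQΩ ha) hH
        (hd _ (hQΩ ha))), htwo.eventually hsub, self_mem_nhdsWithin]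
        with r hr hrQ (hr0 : 0 < r) q hq
      have hqQ : q ∈ Q := hrQ (by rw [mem_closedBall']; linarith)
      refine (hr (e q) (hQΩ hqQ) (by have := he1 a q; linarith)).trans ?_
      rw [hμ_apply]
      gcongr
      intro z hz
      have h1 : e.symm z ∈ closedBall a (2 * r) := by
        have := he2 z (e a)
        rw [MeasurableEquiv.symm_apply_apply] at this
        exact this.trans hz
      have h2 := hQR _ (hrQ h1)
      rw [MeasurableEquiv.apply_symm_apply] at h2
      exact ⟨h1, h2⟩)
    (by rw [hQprod]; exact inter_subset_left)
    (measure_mono_null inter_subset_right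
      (by rwa [hev.measure_preimage_emb e.measurableEmbedding]))
  refine ⟨E ∩ e.symm ⁻¹' Q, inter_mem self_mem_nhdsWithin (nhdsWithin_le_nhds
    (hec'.continuousAt.preimage_mem_nhds (ball_mem_nhds _ (by positivity)))), ?_⟩
  rw [imageMeasure_apply hΩ hF]
  refine measure_mono_null ?_ hnull
  rintro _ ⟨z, ⟨⟨hz1, hz2⟩, _⟩, rfl⟩
  exact ⟨e.symm z, ⟨hz2, by simpa using hz1⟩, by simp⟩

/-- A finite linear combination of quasiconformal maps on a domain
`Ω ⊆ ℂ` maps sets of 2-dimensional Lebesgue measure zero to sets of measure zero. -/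
theorem linear_combination_qc_null_to_null
    (Ω : Set ℂ) (hΩ : IsPlaneDomain Ω) (k : ℕ)
    (α : Fin k → ℂ) (F : Fin k → ℂ → ℂ)
    (hhomeo : ∀ j, ∃ V : Set ℂ, IsOpen V ∧ IsHomeoOn (F j) Ω V)
    (hqc : ∀ j, ∃ H : ℝ≥0∞, H < ⊤ ∧ ∀ w ∈ Ω, dilatationOn (F j) Ω w ≤ H)
    (E : Set ℂ) (hE : E ⊆ Ω) (hE0 : volume E = 0) :
    volume ((fun w => ∑ j, α j * F j w) '' E) = 0 := by
  have hΩ := hΩ.1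
  have hF : ∀ j, Topology.IsOpenEmbedding (Ω.domRestrict (F j)) := fun j => by
    obtain ⟨V, hV, h⟩ := hhomeo j
    exact h.isOpenEmbedding hV
  choose H hH hd using hqc
  set G : ℂ → ℂ := fun w => ∑ j, α j * F j w with hG
  suffices hloc : ∀ p ∈ E, ∃ u ∈ 𝓝[E] p, volume (G '' (E ∩ u)) = 0 by
    choose! u hu hu0 using hloc
    obtain ⟨t, htE, htc, hcov⟩ := TopologicalSpace.countable_cover_nhdsWithin hu
    refine measure_mono_null ?_ ((measure_biUnion_null_iff htc).2 fun p hp => hu0 p (htE hp))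
    rintro _ ⟨z, hz, rfl⟩
    obtain ⟨p, hp, hzp⟩ := mem_iUnion₂.1 (hcov hz)
    exact mem_iUnion₂.2 ⟨p, hp, z, ⟨hz, hzp⟩, rfl⟩
  intro p hp
  obtain ⟨R, hR, hRΩ⟩ := Metric.nhds_basis_closedBall.mem_iff.1 (hΩ.mem_nhds (hE hp))
  refine ⟨ball p R, nhdsWithin_le_nhds (ball_mem_nhds p hR), ?_⟩
  set ρ : Measure ℂ := ∑ j, (imageMeasure (F j) Ω).restrict (closedBall p R) with hρ
  have hfin : ∀ j, IsFiniteMeasure ((imageMeasure (F j) Ω).restrict (closedBall p R)) := fun j =>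
    ⟨by simpa using imageMeasure_lt_top_of_isCompact hΩ (hF j) (isCompact_closedBall p R) hRΩ⟩
  have : IsFiniteMeasure ρ := inferInstance
  have hρ0 : ρ (E ∩ ball p R) = 0 := by
    rw [hρ, Measure.finsetSum_apply]
    refine Finset.sum_eq_zero fun j _ => ?_
    refine measure_mono_null inter_subset_left (Measure.absolutelyContinuous_of_le
      Measure.restrict_le_self ?_)
    exact imageMeasure_absolutelyContinuous hΩ (hF j) (hH j) (hd j) hE hE0
  set A : ℝ≥0∞ := ∑ j, ‖α j‖ₑ * (H j + 1) with hA
  have hAtop : A ≠ ⊤ := by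
    refine (ENNReal.sum_lt_top.2 fun j _ => ?_).ne
    have := (hH j).ne
    finiteness
  set good : ℂ → Set ℝ := fun x => {r | closedBall x r ⊆ closedBall p R ∧ ∀ j, ∀ q ∈ Ω,
    dist x q ≤ r → edist (F j x) (F j q) ^ 2 ≤
      (H j + 1) ^ 2 * imageMeasure (F j) Ω (closedBall x r)} with hgood
  have hgood_ne : ∀ x ∈ E ∩ ball p R, ∀ δ > 0, (good x ∩ Ioo 0 δ).Nonempty := by
    rintro x ⟨hxE, hxB⟩ δ hδ
    have h1 : ∀ᶠ r in 𝓝[>] (0 : ℝ), closedBall x r ⊆ closedBall p R :=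
      nhdsWithin_le_nhds (eventually_closedBall_subset
        (mem_of_superset (isOpen_ball.mem_nhds hxB) ball_subset_closedBall))
    have h2 : ∀ᶠ r in 𝓝[>] (0 : ℝ), ∀ j, ∀ q ∈ Ω, dist x q ≤ r → edist (F j x) (F j q) ^ 2 ≤
        (H j + 1) ^ 2 * imageMeasure (F j) Ω (closedBall x r) :=
      eventually_all.2 fun j =>
        eventually_sq_edist_le_imageMeasure hΩ (hF j) (hE hxE) (hH j) (hd j x (hE hxE))
    have h3 : ∀ᶠ r in 𝓝[>] (0 : ℝ), r ∈ Ioo 0 δ := Ioo_mem_nhdsGT hδ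
    obtain ⟨r, hr1, hr2, hr3⟩ := (h1.and (h2.and h3)).exists
    exact ⟨r, ⟨hr1, hr2⟩, hr3⟩
  have harea : ∀ x, ∀ r ∈ good x, volume (G '' closedBall x r) ≤
      NNReal.pi * A ^ 2 * ρ (closedBall x r) := by
    rintro x r ⟨hr1, hr2⟩
    have hj : ∀ j, imageMeasure (F j) Ω (closedBall x r) ≤ ρ (closedBall x r) := by
      intro j
      rw [hρ, Measure.finsetSum_apply]
      refine le_trans ?_ (Finset.single_le_sum (f := fun j =>
        (imageMeasure (F j) Ω).restrict (closedBall p R) (closedBall x r))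
        (fun _ _ => zero_le) (Finset.mem_univ j))
      rw [Measure.restrict_apply measurableSet_closedBall, inter_eq_left.2 hr1]
    have hsub : G '' closedBall x r ⊆
        closedEBall (G x) (A * ρ (closedBall x r) ^ (1 / 2 : ℝ)) := by
      rintro _ ⟨q, hq, rfl⟩
      have hqΩ : q ∈ Ω := hRΩ (hr1 hq)
      rw [mem_closedEBall, edist_comm, edist_eq_enorm_sub, hG]
      simp only
      rw [← Finset.sum_sub_distrib, hA, Finset.sum_mul]
      refine (enorm_sum_le _ _).trans (Finset.sum_le_sum fun j _ => ?_)
      rw [← mul_sub, enorm_mul, ← edist_eq_enorm_sub, mul_assoc]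
      gcongr
      calc edist (F j x) (F j q) = (edist (F j x) (F j q) ^ 2) ^ (1 / 2 : ℝ) := by
            rw [← ENNReal.rpow_natCast, ← ENNReal.rpow_mul]; norm_num
        _ ≤ ((H j + 1) ^ 2 * ρ (closedBall x r)) ^ (1 / 2 : ℝ) := by
            refine ENNReal.rpow_le_rpow ?_ (by norm_num)
            refine (hr2 j q hqΩ (by rwa [dist_comm])).trans ?_
            exact mul_le_mul_right (hj j) _
        _ = (H j + 1) * ρ (closedBall x r) ^ (1 / 2 : ℝ) := by
            rw [ENNReal.mul_rpow_of_nonneg _ _ (by norm_num), ← ENNReal.rpow_natCast (H j + 1),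
              ← ENNReal.rpow_mul]
            norm_num
    refine (measure_mono hsub).trans_eq ?_
    rw [Complex.volume_closedEBall, mul_pow, ← ENNReal.rpow_natCast (_ ^ _), ← ENNReal.rpow_mul]
    norm_num
    ring
  have hbound : ∀ ε : ℝ≥0∞, ε ≠ 0 → volume (G '' (E ∩ ball p R)) ≤ NNReal.pi * A ^ 2 * ε := by
    intro ε hε
    obtain ⟨t, r, htc, hts, htr, hcov, hsum⟩ :=
      Besicovitch.exists_closedBall_covering_tsum_measure_le ρ hε good (E ∩ ball p R) hgood_ne
    rw [hρ0, zero_add] at hsum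
    have hcov' : G '' (E ∩ ball p R) ⊆ ⋃ x ∈ t, G '' closedBall x (r x) := by
      rw [← image_iUnion₂]
      exact image_mono hcov
    calc volume (G '' (E ∩ ball p R)) ≤ ∑' x : t, volume (G '' closedBall x (r x)) :=
          (measure_mono hcov').trans (measure_biUnion_le _ htc _)
      _ ≤ ∑' x : t, NNReal.pi * A ^ 2 * ρ (closedBall x (r x)) :=
          ENNReal.tsum_le_tsum fun x => harea x _ (htr x x.2)
      _ = NNReal.pi * A ^ 2 * ∑' x : t, ρ (closedBall x (r x)) := ENNReal.tsum_mul_left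
      _ ≤ NNReal.pi * A ^ 2 * ε := by gcongr
  have hlim : Tendsto (fun ε : ℝ≥0∞ => NNReal.pi * A ^ 2 * ε) (𝓝[>] 0) (𝓝 0) := by
    have := ENNReal.Tendsto.const_mul (a := NNReal.pi * A ^ 2) (tendsto_id (x := 𝓝 (0 : ℝ≥0∞)))
      (Or.inr (by finiteness))
    rw [mul_zero] at this
    exact this.mono_left nhdsWithin_le_nhds
  refine le_antisymm (ge_of_tendsto hlim ?_) zero_le
  filter_upwards [self_mem_nhdsWithin] with ε (hε : 0 < ε)
  exact hbound ε hε.ne'
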